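/- Let n4 be the 7-dimensional nilpotent real Lie algebra with basis e1,…,e7 and only nonzero brackets [e1,e2] = −e5, [e1,e3] = −e6 (up to antisymmetry). Then: (i) the space of closed alternating 3-forms on n4 has dimension 27; (ii) the space of derivations of n4 has dimension 27; (iii) the 3-form φ = e^{123}+e^{147}+e^{156}+e^{245}+e^{267}−e^{346}+e^{357} is closed, and the space of derivations of n4 stabilizing φ has dimension 1. -/

import Mathlib

noncomputable section

/-- The underlying 7-dimensional real vector space. -/
abbrev V : Type := Fin 7 → ℝ

/-- The Lie bracket of the nilpotent Lie algebra `n₄` ([e1,e2] = -e5, [e1,e3] = -e6), extended bilinearly from the structure constants. -/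
def bk (x y : V) : V :=
  ![0, 0, 0, 0, -(x 0 * y 1 - x 1 * y 0), -(x 0 * y 2 - x 2 * y 0), 0]

/-- The alternating 3-form `e^i ∧ e^j ∧ e^k` on `V`. -/
def w3 (i j k : Fin 7) : AlternatingMap ℝ V ℝ (Fin 3) :=
  (Matrix.detRowAlternating : AlternatingMap ℝ (Fin 3 → ℝ) ℝ (Fin 3)).compLinearMap
    (LinearMap.pi (fun a => LinearMap.proj (![i, j, k] a)))

/-- Chevalley–Eilenberg differential of a 3-form, as a scalar-valued function. -/
def d3 (φ : AlternatingMap ℝ V ℝ (Fin 3)) (x₀ x₁ x₂ x₃ : V) : ℝ :=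
  -(φ ![bk x₀ x₁, x₂, x₃]) + φ ![bk x₀ x₂, x₁, x₃] - φ ![bk x₀ x₃, x₁, x₂]
    - φ ![bk x₁ x₂, x₀, x₃] + φ ![bk x₁ x₃, x₀, x₂] - φ ![bk x₂ x₃, x₀, x₁]

/-- A 3-form is closed if its Chevalley–Eilenberg differential vanishes. -/
def Closed3 (φ : AlternatingMap ℝ V ℝ (Fin 3)) : Prop :=
  ∀ x₀ x₁ x₂ x₃ : V, d3 φ x₀ x₁ x₂ x₃ = 0

/-- A linear map `D : V → V` is a derivation of the Lie algebra `(V, bk)`. -/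
def IsDeriv (D : V →ₗ[ℝ] V) : Prop :=
  ∀ x y : V, D (bk x y) = bk (D x) y + bk x (D y)

/-- `D` stabilizes (annihilates infinitesimally) the 3-form `φ`. -/
def Stab3 (φ : AlternatingMap ℝ V ℝ (Fin 3)) (D : V →ₗ[ℝ] V) : Prop :=
  ∀ x y z : V, φ ![D x, y, z] + φ ![x, D y, z] + φ ![x, y, D z] = 0

/-- The distinguished 3-form. -/
def phi : AlternatingMap ℝ V ℝ (Fin 3) :=
  w3 0 1 2 + w3 0 3 6 + w3 0 4 5 + w3 1 3 4 + w3 1 5 6 - w3 2 3 5 + w3 2 4 6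

/-- The standard basis vector of `V` with index `i`. -/
def stdVec (i : Fin 7) : V := Pi.single i 1

lemma stdVec_apply (i j : Fin 7) : stdVec i j = if j = i then 1 else 0 := by
  simp [stdVec, Pi.single_apply]

lemma bk_eq_smul_add_smul (x y : V) :
    bk x y = (-(x 0 * y 1 - x 1 * y 0)) • stdVec 4 + (-(x 0 * y 2 - x 2 * y 0)) • stdVec 5 := by
  ext i
  fin_cases i <;> simp [bk, stdVec]

lemma eq_sum_smul_stdVec (x : V) : x = ∑ i, x i • stdVec i :=
  pi_eq_sum_univ' x

section ThreeForms

variable (φ : AlternatingMap ℝ V ℝ (Fin 3))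

lemma map_swap_first_third (x y z : V) : φ ![z, y, x] = -φ ![x, y, z] := by
  have h := φ.map_swap ![x, y, z] (i := 0) (j := 2) (by decide)
  rw [← h]
  congr 1
  ext i
  fin_cases i <;> rfl

lemma map_swap_last_two (x y z : V) : φ ![x, z, y] = -φ ![x, y, z] := by
  have h := φ.map_swap ![x, y, z] (i := 1) (j := 2) (by decide)
  rw [← h]
  congr 1
  ext i
  fin_cases i <;> rfl

/-- An alternating 3-form as a linear map in its first argument. -/
def firstSlot (y z : V) : V →ₗ[ℝ] ℝ where
  toFun x := φ ![x, y, z]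
  map_add' x x' := φ.toMultilinearMap.cons_add ![y, z] x x'
  map_smul' c x := φ.toMultilinearMap.cons_smul ![y, z] c x

lemma firstSlot_apply (x y z : V) : firstSlot φ y z x = φ ![x, y, z] := rfl

lemma map_bk (x y z w : V) :
    φ ![bk x y, z, w] = -(x 0 * y 1 - x 1 * y 0) * φ ![stdVec 4, z, w]
      - (x 0 * y 2 - x 2 * y 0) * φ ![stdVec 5, z, w] := by
  have h := congrArg (firstSlot φ z w) (bk_eq_smul_add_smul x y)
  simp only [map_add, map_smul, smul_eq_mul, firstSlot_apply] at h
  linear_combination h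

lemma map_first_eq_sum (x y z : V) : φ ![x, y, z] = ∑ i, x i * φ ![stdVec i, y, z] := by
  have h := congrArg (firstSlot φ y z) (eq_sum_smul_stdVec x)
  simpa only [map_sum, map_smul, smul_eq_mul, firstSlot_apply] using h

lemma map_last_eq_sum (x y z : V) : φ ![x, y, z] = ∑ i, z i * φ ![x, y, stdVec i] := by
  rw [← neg_inj, ← map_swap_first_third, map_first_eq_sum, ← Finset.sum_neg_distrib]
  refine Finset.sum_congr rfl fun i _ => ?_
  rw [map_swap_first_third, mul_neg]

lemma map_middle_eq_sum (x y z : V) : φ ![x, y, z] = ∑ i, y i * φ ![x, stdVec i, z] := by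
  rw [← neg_inj, ← map_swap_last_two, map_last_eq_sum, ← Finset.sum_neg_distrib]
  refine Finset.sum_congr rfl fun i _ => ?_
  rw [map_swap_last_two, mul_neg]

lemma map_eq_sum_lt (x y z : V) :
    φ ![x, y, z] = ∑ i, ∑ j,
      if i < j then (y i * z j - y j * z i) * φ ![x, stdVec i, stdVec j] else 0 := by
  have diag (i : Fin 7) : φ ![x, stdVec i, stdVec i] = 0 := by
    linarith [map_swap_last_two φ x (stdVec i) (stdVec i)]
  have anti (i j : Fin 7) (_ : j < i) :
      φ ![x, stdVec i, stdVec j] = -φ ![x, stdVec j, stdVec i] :=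
    map_swap_last_two φ x _ _
  rw [map_middle_eq_sum]
  simp_rw [map_last_eq_sum φ x (stdVec _) z]
  simp [Fin.sum_univ_seven, diag, anti]
  ring

end ThreeForms

/-- The components of the differential of a 3-form, up to sign and redundancy. -/
def closedConstraint : AlternatingMap ℝ V ℝ (Fin 3) →ₗ[ℝ] (Fin 8 → ℝ) where
  toFun φ :=
    let a i j := φ ![stdVec 4, stdVec i, stdVec j]
    let b i j := φ ![stdVec 5, stdVec i, stdVec j]
    ![b 1 3 - a 2 3, a 1 5, a 2 5, b 1 6 - a 2 6, a 3 5, a 3 6, a 5 6, b 3 6]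
  map_add' φ ψ := by
    ext i
    fin_cases i <;> simp <;> ring
  map_smul' c φ := by
    ext i
    fin_cases i <;> simp <;> ring

lemma closed3_iff_closedConstraint_eq_zero (φ : AlternatingMap ℝ V ℝ (Fin 3)) :
    Closed3 φ ↔ closedConstraint φ = 0 := by
  have diag₁ (i j : Fin 7) : φ ![stdVec i, stdVec j, stdVec i] = 0 := by
    linarith [map_swap_first_third φ (stdVec i) (stdVec j) (stdVec i)]
  have cross₁ (i : Fin 7) :
      φ ![stdVec 5, stdVec i, stdVec 4] = -φ ![stdVec 4, stdVec i, stdVec 5] :=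
    map_swap_first_third φ _ _ _
  have cross₂ (i : Fin 7) :
      φ ![stdVec 5, stdVec 4, stdVec i] = φ ![stdVec 4, stdVec i, stdVec 5] := by
    rw [← neg_inj, ← map_swap_last_two, cross₁]
  have cross₃ (i : Fin 7) :
      φ ![stdVec 4, stdVec 5, stdVec i] = -φ ![stdVec 4, stdVec i, stdVec 5] :=
    map_swap_last_two φ _ _ _
  have diag₂ (i j : Fin 7) : φ ![stdVec i, stdVec i, stdVec j] = 0 := by
    linarith [map_swap_last_two φ (stdVec i) (stdVec i) (stdVec j), diag₁ i j]
  constructor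
  · intro h
    have component (i j k l : Fin 7) := h (stdVec i) (stdVec j) (stdVec k) (stdVec l)
    simp only [d3, map_bk, stdVec_apply] at component
    have h₀ := component 0 1 2 3
    have h₁ := component 0 1 2 4
    have h₂ := component 0 1 2 5
    have h₃ := component 0 1 2 6
    have h₄ := component 0 1 3 5
    have h₅ := component 0 1 3 6
    have h₆ := component 0 1 5 6
    have h₇ := component 0 2 3 6
    simp [diag₁, diag₂, cross₁, cross₃] at h₀ h₁ h₂ h₃ h₄ h₅ h₆ h₇
    ext i
    fin_cases i <;> simp [closedConstraint, cross₃] <;> linarith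
  · intro h x₀ x₁ x₂ x₃
    have h₀ := congrFun h 0
    have h₁ := congrFun h 1
    have h₂ := congrFun h 2
    have h₃ := congrFun h 3
    have h₄ := congrFun h 4
    have h₅ := congrFun h 5
    have h₆ := congrFun h 6
    have h₇ := congrFun h 7
    simp [closedConstraint, cross₃] at h₀ h₁ h₂ h₃ h₄ h₅ h₆ h₇
    rw [sub_eq_zero] at h₀ h₃
    have expand (x y z w : V) := (map_bk φ x y z w).trans (congrArg₂
      (fun a b => -(x 0 * y 1 - x 1 * y 0) * a - (x 0 * y 2 - x 2 * y 0) * b)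
      (map_eq_sum_lt φ (stdVec 4) z w) (map_eq_sum_lt φ (stdVec 5) z w))
    simp only [d3, expand]
    simp [Fin.sum_univ_seven, diag₁, diag₂, cross₁, cross₂, cross₃, h₀, h₁, h₂, h₃, h₄, h₅, h₆, h₇]
    ring

lemma w3_apply (i j k : Fin 7) (x y z : V) :
    w3 i j k ![x, y, z] = x i * y j * z k - x i * y k * z j - x j * y i * z k + x j * y k * z i
      + x k * y i * z j - x k * y j * z i := by
  change (Matrix.of fun a b => ![x, y, z] a (![i, j, k] b)).det = _
  rw [Matrix.det_fin_three]
  simp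

lemma closedConstraint_surjective : Function.Surjective closedConstraint := by
  intro v
  refine ⟨v 0 • w3 1 3 5 - v 1 • w3 1 4 5 - v 2 • w3 2 4 5 - v 3 • w3 1 5 6 - v 4 • w3 3 4 5
    - v 5 • w3 3 4 6 + v 6 • w3 4 5 6 - v 7 • w3 3 5 6, ?_⟩
  ext i
  fin_cases i <;> simp [closedConstraint, w3_apply, stdVec_apply]

lemma finrank_threeForms : Module.finrank ℝ (AlternatingMap ℝ V ℝ (Fin 3)) = 35 := by
  rw [exteriorPower.alternatingMapLinearEquiv.finrank_eq]
  change Module.finrank ℝ (Module.Dual ℝ _) = 35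
  rw [Subspace.dual_finrank_eq, exteriorPower.finrank_eq]
  simp [Nat.choose]

/-- The entries of a derivation's defect on basis vectors, up to sign and redundancy. -/
def derivConstraint : Matrix (Fin 7) (Fin 7) ℝ →ₗ[ℝ] (Fin 22 → ℝ) where
  toFun m :=
    ![m 0 0 + m 1 1 - m 4 4, m 2 1 - m 5 4, m 0 0 + m 2 2 - m 5 5, m 1 2 - m 4 5, m 0 1, m 0 2,
      m 0 3, m 1 3, m 2 3, m 0 6, m 1 6, m 2 6, m 0 4, m 1 4, m 2 4, m 3 4, m 6 4, m 0 5, m 1 5,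
      m 2 5, m 3 5, m 6 5]
  map_add' m n := by
    ext i
    fin_cases i <;> simp <;> ring
  map_smul' c m := by
    ext i
    fin_cases i <;> simp <;> ring

lemma derivConstraint_surjective : Function.Surjective derivConstraint := by
  intro v
  refine ⟨!![0, v 4, v 5, v 6, v 12, v 17, v 9;
      0, 0, 0, v 7, v 13, v 18, v 10;
      0, 0, 0, v 8, v 14, v 19, v 11;
      0, 0, 0, 0, v 15, v 20, 0;
      0, 0, 0, 0, -v 0, -v 3, 0;
      0, 0, 0, 0, -v 1, -v 2, 0;
      0, 0, 0, 0, v 16, v 21, 0], ?_⟩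
  ext i
  fin_cases i <;> simp [derivConstraint]

lemma apply_eq_sum_toMatrix' (D : V →ₗ[ℝ] V) (x : V) (i : Fin 7) :
    D x i = ∑ j, D.toMatrix' i j * x j := by
  rw [← D.toMatrix'_mulVec x]
  rfl

lemma isDeriv_iff_derivConstraint_eq_zero (D : V →ₗ[ℝ] V) :
    IsDeriv D ↔ derivConstraint D.toMatrix' = 0 := by
  have apply_eq := apply_eq_sum_toMatrix' D
  generalize D.toMatrix' = m at apply_eq ⊢
  constructor
  · intro h
    have h₀₁ := h (stdVec 0) (stdVec 1)
    have h₀₂ := h (stdVec 0) (stdVec 2)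
    have h₁₂ := h (stdVec 1) (stdVec 2)
    have h₀₃ := h (stdVec 0) (stdVec 3)
    have h₁₃ := h (stdVec 1) (stdVec 3)
    have h₀₆ := h (stdVec 0) (stdVec 6)
    have h₁₆ := h (stdVec 1) (stdVec 6)
    simp [funext_iff, Fin.forall_fin_succ, apply_eq, Fin.sum_univ_seven, bk, stdVec_apply]
      at h₀₁ h₀₂ h₁₂ h₀₃ h₁₃ h₀₆ h₁₆
    ext i
    fin_cases i <;> simp [derivConstraint] <;> grind
  · intro h x y
    simp [funext_iff, Fin.forall_fin_succ, derivConstraint] at h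
    ext i
    fin_cases i <;> simp [apply_eq, Fin.sum_univ_seven, bk] <;> grind

/-- The matrix of a derivation spanning the stabilizer of `phi`. -/
def stabGenerator : Matrix (Fin 7) (Fin 7) ℝ :=
  !![0, 0, 0, 0, 0, 0, 0;
    0, 0, 1, 0, 0, 0, 0;
    0, -1, 0, 0, 0, 0, 0;
    0, 0, 0, 0, 0, 0, -2;
    0, 0, 0, 0, 0, 1, 0;
    0, 0, 0, 0, -1, 0, 0;
    0, 0, 0, 2, 0, 0, 0]

lemma phi_apply (x y z : V) :
    phi ![x, y, z] = w3 0 1 2 ![x, y, z] + w3 0 3 6 ![x, y, z] + w3 0 4 5 ![x, y, z]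
      + w3 1 3 4 ![x, y, z] + w3 1 5 6 ![x, y, z] - w3 2 3 5 ![x, y, z] + w3 2 4 6 ![x, y, z] :=
  rfl

lemma closed3_phi : Closed3 phi := by
  rw [closed3_iff_closedConstraint_eq_zero]
  ext i
  fin_cases i <;> simp [closedConstraint, phi_apply, w3_apply, stdVec_apply]

set_option maxHeartbeats 2000000 in
lemma eq_smul_stabGenerator {D : V →ₗ[ℝ] V} (hD : IsDeriv D) (hS : Stab3 phi D) :
    (D.toMatrix' 6 3 / 2) • stabGenerator.toLin' = D := by
  rw [isDeriv_iff_derivConstraint_eq_zero] at hD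
  have apply_eq := apply_eq_sum_toMatrix' D
  apply LinearMap.toMatrix'.injective
  rw [map_smul, LinearMap.toMatrix'_toLin']
  generalize D.toMatrix' = m at apply_eq hD ⊢
  simp [funext_iff, Fin.forall_fin_succ, derivConstraint] at hD
  have component (i j k : Fin 7) := hS (stdVec i) (stdVec j) (stdVec k)
  simp only [phi_apply, w3_apply, apply_eq, Fin.sum_univ_seven, stdVec_apply] at component
  have h012 := component 0 1 2
  have h013 := component 0 1 3
  have h014 := component 0 1 4
  have h015 := component 0 1 5
  have h016 := component 0 1 6
  have h023 := component 0 2 3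
  have h024 := component 0 2 4
  have h025 := component 0 2 5
  have h026 := component 0 2 6
  have h034 := component 0 3 4
  have h035 := component 0 3 5
  have h036 := component 0 3 6
  have h045 := component 0 4 5
  have h046 := component 0 4 6
  have h056 := component 0 5 6
  have h123 := component 1 2 3
  have h124 := component 1 2 4
  have h125 := component 1 2 5
  have h126 := component 1 2 6
  have h134 := component 1 3 4
  have h135 := component 1 3 5
  have h136 := component 1 3 6
  have h146 := component 1 4 6
  have h156 := component 1 5 6
  have h236 := component 2 3 6
  have h256 := component 2 5 6
  simp [hD] at h012 h013 h014 h015 h016 h023 h024 h025 h026 h034 h035 h036 h045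
  simp [hD] at h046 h056 h123 h124 h125 h126 h134 h135 h136 h146 h156 h236 h256
  clear component apply_eq
  ext i j
  fin_cases i <;> fin_cases j <;> simp [stabGenerator] <;> linarith

lemma isDeriv_smul_stabGenerator (c : ℝ) : IsDeriv (c • stabGenerator.toLin') := by
  rw [isDeriv_iff_derivConstraint_eq_zero, map_smul, LinearMap.toMatrix'_toLin', map_smul]
  refine smul_eq_zero_of_right c ?_
  ext i
  fin_cases i <;> simp [derivConstraint, stabGenerator]

lemma stab3_phi_smul_stabGenerator (c : ℝ) : Stab3 phi (c • stabGenerator.toLin') := by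
  intro x y z
  simp [phi_apply, w3_apply, stabGenerator, dotProduct, Fin.sum_univ_seven]
  ring

lemma isDeriv_and_stab3_phi_iff (D : V →ₗ[ℝ] V) :
    IsDeriv D ∧ Stab3 phi D ↔ ∃ c : ℝ, c • stabGenerator.toLin' = D := by
  refine ⟨fun h => ⟨_, eq_smul_stabGenerator h.1 h.2⟩, ?_⟩
  rintro ⟨c, rfl⟩
  exact ⟨isDeriv_smul_stabGenerator c, stab3_phi_smul_stabGenerator c⟩

theorem statement_0 :
    (∃ Z : Submodule ℝ (AlternatingMap ℝ V ℝ (Fin 3)),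
      (∀ φ, φ ∈ Z ↔ Closed3 φ) ∧ Module.finrank ℝ Z = 27) ∧
    (∃ W : Submodule ℝ (V →ₗ[ℝ] V),
      (∀ D, D ∈ W ↔ IsDeriv D) ∧ Module.finrank ℝ W = 27) ∧
    Closed3 phi ∧
    (∃ S : Submodule ℝ (V →ₗ[ℝ] V),
      (∀ D, D ∈ S ↔ IsDeriv D ∧ Stab3 phi D) ∧ Module.finrank ℝ S = 1) := by
  refine ⟨⟨LinearMap.ker closedConstraint, fun φ => ?_, ?_⟩,
    ⟨LinearMap.ker (derivConstraint ∘ₗ LinearMap.toMatrix'.toLinearMap), fun D => ?_, ?_⟩,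
    closed3_phi, ⟨Submodule.span ℝ {stabGenerator.toLin'}, fun D => ?_, ?_⟩⟩
  · rw [LinearMap.mem_ker, closed3_iff_closedConstraint_eq_zero]
  · have : Module.Finite ℝ (AlternatingMap ℝ V ℝ (Fin 3)) :=
      Module.finite_of_finrank_pos (by simp [finrank_threeForms])
    have h := closedConstraint.finrank_range_add_finrank_ker
    rw [LinearMap.range_eq_top.2 closedConstraint_surjective, finrank_top, finrank_threeForms,
      Module.finrank_fin_fun] at h
    lia
  · rw [LinearMap.mem_ker, isDeriv_iff_derivConstraint_eq_zero]
    rfl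
  · have hs : Function.Surjective
        (derivConstraint ∘ₗ (LinearMap.toMatrix' (R := ℝ) (m := Fin 7) (n := Fin 7)).toLinearMap) :=
      derivConstraint_surjective.comp (LinearEquiv.surjective _)
    have h := LinearMap.finrank_range_add_finrank_ker
      (derivConstraint ∘ₗ (LinearMap.toMatrix' (R := ℝ) (m := Fin 7) (n := Fin 7)).toLinearMap)
    rw [LinearMap.range_eq_top.2 hs, finrank_top, Module.finrank_fin_fun,
      Module.finrank_linearMap, Module.finrank_fin_fun] at h
    lia
  · rw [Submodule.mem_span_singleton, isDeriv_and_stab3_phi_iff]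
  · refine finrank_span_singleton fun h => ?_
    have h' := congrFun (congrFun ((LinearEquiv.map_eq_zero_iff Matrix.toLin').1 h) 1) 2
    simp [stabGenerator] at h'
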